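/- arXiv:1412.1769 — 3 statements merged into one kernel-verified Lean document; each statement's English description precedes it below -/
import Mathlib

section
/- Let S be a simply connected subset of ℝ², and let ℓ and ℓ' be line segments contained in S. Then the set vis(ℓ', S) ∩ ℓ of points of ℓ visible from ℓ' in S is convex (hence a possibly empty subsegment of ℓ). -/
/-- A line segment in the plane: a bounded convex subset of a line. -/
def IsLineSegment (ℓ : Set (ℝ × ℝ)) : Prop :=
  Convex ℝ ℓ ∧ Bornology.IsBounded ℓ ∧
    ∃ a b : ℝ × ℝ, a ≠ b ∧ ℓ ⊆ Set.range (AffineMap.lineMap a b : ℝ →ᵃ[ℝ] ℝ × ℝ)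

lemma aux_split {P Q C x : ℝ × ℝ} (hC : C ∈ segment ℝ P Q) (hx : x ∈ segment ℝ P Q) :
    x ∈ segment ℝ P C ∨ x ∈ segment ℝ C Q := by
  rw [segment_eq_image_lineMap] at hC hx
  obtain ⟨k, hk, rfl⟩ := hC
  obtain ⟨r, hr, rfl⟩ := hx
  have im : ∀ a b : ℝ, a ≤ b → r ∈ Set.Icc a b →
      (AffineMap.lineMap P Q r : ℝ × ℝ) ∈
        segment ℝ (AffineMap.lineMap P Q a : ℝ × ℝ) (AffineMap.lineMap P Q b) := by
    intro a b hab h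
    rw [← image_segment, segment_eq_Icc hab]
    exact ⟨r, h, rfl⟩
  rcases le_total r k with h | h
  · left; simpa using im 0 k hk.1 ⟨hr.1, h⟩
  · right; simpa using im k 1 hk.2 ⟨h, hr.2⟩

open Complex in
/-- Continuous logarithms along homotopic paths have the same end value. -/
lemma aux_lift_unique {X : Type*} [TopologicalSpace X] [SimplyConnectedSpace X]
    (f : X → ℂ) (hf : Continuous f) (h0 : ∀ x, f x ≠ 0) {x y : X} (g₀ g₁ : Path x y)
    {w z₀ z₁ : ℂ} (G₀ : Path w z₀) (G₁ : Path w z₁)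
    (h₀ : ∀ t, exp (G₀ t) = f (g₀ t)) (h₁ : ∀ t, exp (G₁ t) = f (g₁ t)) : z₀ = z₁ := by
  let F : C(X, {z : ℂ // z ≠ 0}) := ⟨fun x => ⟨f x, h0 x⟩, by fun_prop⟩
  have hom : (F.comp g₀.toContinuousMap).HomotopicRel (F.comp g₁.toContinuousMap) {0, 1} :=
    ContinuousMap.HomotopicRel.comp_continuousMap
      (SimplyConnectedSpace.paths_homotopic g₀ g₁) F
  have cov := Complex.isCoveringMap_exp
  have e₀ : (F.comp g₀.toContinuousMap) 0 = ⟨exp w, exp_ne_zero w⟩ := by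
    apply Subtype.ext
    have := h₀ 0
    simp only [Path.source] at this
    simp [F, this]
  have e₁ : (F.comp g₁.toContinuousMap) 0 = ⟨exp w, exp_ne_zero w⟩ := by
    apply Subtype.ext
    have := h₁ 0
    simp only [Path.source] at this
    simp [F, this]
  have key := cov.liftPath_apply_one_eq_of_homotopicRel hom w e₀ e₁
  have l₀ : G₀.toContinuousMap = cov.liftPath (F.comp g₀.toContinuousMap) w e₀ :=
    (cov.eq_liftPath_iff' e₀).mpr ⟨by
      funext t; apply Subtype.ext; exact h₀ t, G₀.source⟩
  have l₁ : G₁.toContinuousMap = cov.liftPath (F.comp g₁.toContinuousMap) w e₁ :=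
    (cov.eq_liftPath_iff' e₁).mpr ⟨by
      funext t; apply Subtype.ext; exact h₁ t, G₁.source⟩
  rw [← l₀, ← l₁] at key
  have a := G₀.target
  have b := G₁.target
  rw [← a, ← b]
  exact key

/-- If the segment from `a` to `b` avoids `0`, then `b / a` lies in the slit plane. -/
lemma aux_slit {a b : ℂ} (h : ∀ t : ℝ, 0 ≤ t → t ≤ 1 → (1 - t) * a + t * b ≠ 0) :
    b / a ∈ Complex.slitPlane := by
  have ha : a ≠ 0 := by simpa using h 0 le_rfl zero_le_one
  rw [Complex.mem_slitPlane_iff]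
  by_contra! hc
  obtain ⟨hre, him⟩ := hc
  have hr : b / a = ((b / a).re : ℂ) := by
    apply Complex.ext <;> simp [him]
  set r := (b / a).re with hrdef
  have hb : b = r * a := by
    field_simp at hr
    rw [hr, mul_comm]
  have h1 : (0:ℝ) < 1 - r := by linarith
  have h1c : (1 : ℂ) - r ≠ 0 := by exact_mod_cast h1.ne'
  apply h (1 / (1 - r)) (by positivity) (by rw [div_le_one h1]; linarith)
  rw [hb]
  push_cast
  field_simp
  ring

/-- Chord of a segment, as a path in `S`. -/
def auxSeg {S : Set (ℝ × ℝ)} {P Q : ℝ × ℝ} (hP : P ∈ S) (hQ : Q ∈ S)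
    (h : segment ℝ P Q ⊆ S) : Path (⟨P, hP⟩ : S) ⟨Q, hQ⟩ where
  toFun t := ⟨AffineMap.lineMap P Q (t : ℝ), h (by
    rw [segment_eq_image_lineMap]; exact ⟨t, t.2, rfl⟩)⟩
  continuous_toFun := by
    apply Continuous.subtype_mk
    exact AffineMap.lineMap_continuous.comp continuous_subtype_val
  source' := by simp
  target' := by simp

/-- the complex number `x - p`. -/
def auxZ (p x : ℝ × ℝ) : ℂ := ⟨x.1 - p.1, x.2 - p.2⟩

lemma auxZ_cont (p : ℝ × ℝ) : Continuous (auxZ p) := by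
  have : auxZ p = fun x => ((x.1 - p.1 : ℝ) : ℂ) + ((x.2 - p.2 : ℝ) : ℂ) * Complex.I := by
    funext x
    apply Complex.ext <;> simp [auxZ]
  rw [this]
  fun_prop

lemma auxZ_ne {p x : ℝ × ℝ} (h : x ≠ p) : auxZ p x ≠ 0 := by
  intro h0
  apply h
  have h1 := congrArg Complex.re h0
  have h2 := congrArg Complex.im h0
  simp only [auxZ, Complex.zero_re, Complex.zero_im] at h1 h2
  ext <;> linarith

lemma auxZ_lineMap (p P Q : ℝ × ℝ) (t : ℝ) :
    auxZ p (AffineMap.lineMap P Q t) = (1 - t) * auxZ p P + t * auxZ p Q := by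
  apply Complex.ext <;> simp [auxZ, AffineMap.lineMap_apply] <;> ring

lemma aux_seg_slit {S : Set (ℝ × ℝ)} {p P Q : ℝ × ℝ} (hp : p ∉ S)
    (h : segment ℝ P Q ⊆ S) : auxZ p Q / auxZ p P ∈ Complex.slitPlane := by
  apply aux_slit
  intro t h0 h1
  rw [← auxZ_lineMap]
  apply auxZ_ne
  rintro rfl
  exact hp (h (by rw [segment_eq_image_lineMap]; exact ⟨t, ⟨h0, h1⟩, rfl⟩))

lemma aux_seg_lift {S : Set (ℝ × ℝ)} {p P Q : ℝ × ℝ} (hp : p ∉ S) (hP : P ∈ S) (hQ : Q ∈ S)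
    (h : segment ℝ P Q ⊆ S) (w : ℂ) (hw : Complex.exp w = auxZ p P) :
    ∃ G : Path w (w + Complex.log (auxZ p Q / auxZ p P)),
      ∀ t, Complex.exp (G t) = auxZ p (auxSeg hP hQ h t : S).1 := by
  have hPne : auxZ p P ≠ 0 := auxZ_ne (fun e => hp (e ▸ hP))
  have hsl := aux_seg_slit hp h
  have hsl' : ∀ t : unitInterval,
      auxZ p (AffineMap.lineMap P Q (t:ℝ)) / auxZ p P ∈ Complex.slitPlane := by
    intro t
    have := Complex.starConvex_one_slitPlane hsl (a := 1 - t) (b := t) (by linarith [t.2.2])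
      t.2.1 (by ring)
    convert this using 1
    rw [auxZ_lineMap]
    simp only [Complex.real_smul]
    push_cast
    field_simp
  refine ⟨⟨⟨fun t => w + Complex.log (auxZ p (AffineMap.lineMap P Q (t:ℝ)) / auxZ p P), ?_⟩,
    ?_, ?_⟩, ?_⟩
  · apply continuous_const.add
    apply Continuous.clog _ hsl'
    apply Continuous.div_const
    exact (auxZ_cont p).comp (AffineMap.lineMap_continuous.comp continuous_subtype_val)
  · simp [hPne]
  · simp
  · intro t
    change Complex.exp (w + Complex.log (auxZ p (AffineMap.lineMap P Q (t:ℝ)) / auxZ p P)) =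
      auxZ p (AffineMap.lineMap P Q (t:ℝ))
    rw [Complex.exp_add, hw, Complex.exp_log (Complex.slitPlane_ne_zero (hsl' t))]
    field_simp

/-- The total turning of a quadrilateral in `S` around a point outside of `S` is zero. -/
lemma aux_arg_sum {S : Set (ℝ × ℝ)} [SimplyConnectedSpace S] {p P Q R T : ℝ × ℝ} (hp : p ∉ S)
    (hPQ : segment ℝ P Q ⊆ S) (hQR : segment ℝ Q R ⊆ S)
    (hPT : segment ℝ P T ⊆ S) (hTR : segment ℝ T R ⊆ S) :
    Complex.log (auxZ p Q / auxZ p P) + Complex.log (auxZ p R / auxZ p Q) =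
      Complex.log (auxZ p T / auxZ p P) + Complex.log (auxZ p R / auxZ p T) := by
  have hP : P ∈ S := hPQ (left_mem_segment ℝ P Q)
  have hQ : Q ∈ S := hPQ (right_mem_segment ℝ P Q)
  have hR : R ∈ S := hQR (right_mem_segment ℝ Q R)
  have hT : T ∈ S := hPT (right_mem_segment ℝ P T)
  have ne : ∀ X ∈ S, auxZ p X ≠ 0 := fun X hX => auxZ_ne (fun e => hp (e ▸ hX))
  have hw := Complex.exp_log (ne P hP)
  obtain ⟨G1, h1⟩ := aux_seg_lift hp hP hQ hPQ _ hw
  obtain ⟨G2, h2⟩ := aux_seg_lift hp hQ hR hQR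
    (Complex.log (auxZ p P) + Complex.log (auxZ p Q / auxZ p P)) (by
      have := ne P hP
      rw [Complex.exp_add, hw, Complex.exp_log (div_ne_zero (ne Q hQ) this)]; field_simp)
  obtain ⟨G3, h3⟩ := aux_seg_lift hp hP hT hPT _ hw
  obtain ⟨G4, h4⟩ := aux_seg_lift hp hT hR hTR
    (Complex.log (auxZ p P) + Complex.log (auxZ p T / auxZ p P)) (by
      have := ne P hP
      rw [Complex.exp_add, hw, Complex.exp_log (div_ne_zero (ne T hT) this)]; field_simp)
  have key := aux_lift_unique (fun x : S => auxZ p x.1)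
    ((auxZ_cont p).comp continuous_subtype_val) (fun x => ne x.1 x.2)
    ((auxSeg hP hQ hPQ).trans (auxSeg hQ hR hQR)) ((auxSeg hP hT hPT).trans (auxSeg hT hR hTR))
    (G1.trans G2) (G3.trans G4)
    (by intro t; simp only [Path.trans_apply]; split_ifs <;> simp [h1, h2])
    (by intro t; simp only [Path.trans_apply]; split_ifs <;> simp [h3, h4])
  linear_combination key

lemma aux_arg_mul {x y : ℂ} (hx : x ∈ Complex.slitPlane) (hy : y ∈ Complex.slitPlane)
    (hxy : 0 ≤ (x * y).im) (h : 0 ≤ x.im ∨ 0 ≤ y.im) : 0 ≤ x.arg + y.arg := by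
  have hx0 := Complex.slitPlane_ne_zero hx
  have hy0 := Complex.slitPlane_ne_zero hy
  have hx1 := Complex.neg_pi_lt_arg x
  have hy1 := Complex.neg_pi_lt_arg y
  have hx2 := Complex.arg_le_pi x
  have hy2 := Complex.arg_le_pi y
  have mul : x.arg + y.arg ∈ Set.Ioc (-Real.pi) Real.pi → 0 ≤ x.arg + y.arg := by
    intro hm
    rw [← Complex.arg_mul hx0 hy0 hm]
    exact Complex.arg_nonneg_iff.mpr hxy
  by_cases h1 : 0 ≤ x.arg
  · by_cases h2 : 0 ≤ y.arg
    · linarith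
    · exact mul ⟨by linarith, by linarith⟩
  · have : 0 ≤ y.arg := by
      rw [Complex.arg_nonneg_iff] at *
      tauto
    exact mul ⟨by linarith, by linarith⟩

lemma aux_div_im (a b : ℂ) :
    (b / a).im = (a.re * b.im - a.im * b.re) / Complex.normSq a := by
  rw [Complex.div_im]; ring

lemma aux_pos_of_arg {a b : ℂ} (h : b / a ∈ Complex.slitPlane) (h0 : (b / a).arg = 0) :
    ∃ r : ℝ, 0 < r ∧ b = r * a := by
  have hne := Complex.slitPlane_ne_zero h
  have ha : a ≠ 0 := by rintro rfl; simp at hne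
  refine ⟨‖b / a‖, norm_pos_iff.mpr hne, ?_⟩
  have := Complex.norm_mul_exp_arg_mul_I (b / a)
  rw [h0] at this
  simp only [Complex.ofReal_zero, zero_mul, Complex.exp_zero, mul_one] at this
  rw [this]
  field_simp

/-- Complex version of the quadrilateral lemma. -/
lemma aux_complex {a b c d : ℂ} (hab : b / a ∈ Complex.slitPlane) (hbc : c / b ∈ Complex.slitPlane)
    (had : d / a ∈ Complex.slitPlane) (hdc : c / d ∈ Complex.slitPlane)
    (hsum : Complex.log (b / a) + Complex.log (c / b) = Complex.log (d / a) + Complex.log (c / d))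
    {α β γ : ℝ} (hα : 0 ≤ α) (hβ : 0 ≤ β) (hγ : 0 ≤ γ) (h1 : α + β + γ = 1)
    (h0 : α * a + β * b + γ * c = 0)
    (ho1 : 0 ≤ (a.re * b.im - a.im * b.re) + (b.re * c.im - b.im * c.re)
      + (c.re * a.im - c.im * a.re))
    (ho2 : 0 ≤ (a.re * c.im - a.im * c.re) + (c.re * d.im - c.im * d.re)
      + (d.re * a.im - d.im * a.re)) : False := by
  have ha : a ≠ 0 := by rintro rfl; simp at hab
  have hb : b ≠ 0 := by rintro rfl; simp at hbc
  have hd : d ≠ 0 := by rintro rfl; simp at hdc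
  have hc : c ≠ 0 := by rintro rfl; simp at hbc
  have hre := congrArg Complex.re h0
  have him := congrArg Complex.im h0
  simp at hre him
  set o := (a.re * b.im - a.im * b.re) + (b.re * c.im - b.im * c.re)
      + (c.re * a.im - c.im * a.re) with ho
  have hγ' : a.re * b.im - a.im * b.re = γ * o := by
    rw [ho]
    have e : γ = 1 - α - β := by linarith
    linear_combination (a.re * b.im - a.im * b.re) * (-h1) +
      (b.im - a.im) * hre - (b.re - a.re) * him
  have hα' : b.re * c.im - b.im * c.re = α * o := by
    rw [ho]
    linear_combination (b.re * c.im - b.im * c.re) * (-h1) +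
      (c.im - b.im) * hre - (c.re - b.re) * him
  have hβ' : c.re * a.im - c.im * a.re = β * o := by
    rw [ho]
    linear_combination (c.re * a.im - c.im * a.re) * (-h1) +
      (a.im - c.im) * hre - (a.re - c.re) * him
  have nn : ∀ z : ℂ, 0 ≤ Complex.normSq z := Complex.normSq_nonneg
  have i1 : 0 ≤ (b / a).arg := by
    rw [Complex.arg_nonneg_iff, aux_div_im, hγ']
    exact div_nonneg (by positivity) (nn a)
  have i2 : 0 ≤ (c / b).arg := by
    rw [Complex.arg_nonneg_iff, aux_div_im, hα']
    exact div_nonneg (by positivity) (nn b)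
  have inv : ∀ x y : ℂ, x / y ∈ Complex.slitPlane →
      y / x ∈ Complex.slitPlane ∧ (y / x).arg = - (x / y).arg := by
    intro x y h
    have e : y / x = (x / y)⁻¹ := by rw [inv_div]
    rw [e]
    refine ⟨by
      rw [Complex.mem_slitPlane_iff_arg] at h ⊢
      rw [Complex.arg_inv, if_neg h.1]
      refine ⟨?_, inv_ne_zero h.2⟩
      have := Complex.neg_pi_lt_arg (x / y)
      intro hh
      linarith, ?_⟩
    rw [Complex.arg_inv, if_neg (Complex.mem_slitPlane_iff_arg.mp h).1]
  obtain ⟨s1, t1⟩ := inv _ _ had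
  obtain ⟨s2, t2⟩ := inv _ _ hdc
  have i3 : 0 ≤ (d / c).arg + (a / d).arg := by
    apply aux_arg_mul s2 s1
    · have : d / c * (a / d) = a / c := by field_simp
      rw [this, aux_div_im]
      exact div_nonneg (by rw [hβ']; positivity) (nn c)
    · rw [aux_div_im, aux_div_im]
      by_cases hh : 0 ≤ c.re * d.im - c.im * d.re
      · left; exact div_nonneg hh (nn c)
      · right
        refine div_nonneg ?_ (nn d)
        have : 0 ≤ β * o := by positivity
        linarith
  have hs := congrArg Complex.im hsum
  simp only [Complex.add_im, Complex.log_im] at hs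
  obtain ⟨r, hr, er⟩ := aux_pos_of_arg hab (by linarith)
  obtain ⟨s, hs, es⟩ := aux_pos_of_arg hbc (by linarith)
  have : ((α + β * r + γ * (s * r) : ℝ) : ℂ) * a = 0 := by
    rw [← h0, es, er]; push_cast; ring
  rcases mul_eq_zero.mp this with h | h
  · have h' : α + β * r + γ * (s * r) = 0 := by exact_mod_cast h
    have p1 : 0 ≤ β * r := by positivity
    have p2 : 0 ≤ γ * (s * r) := by positivity
    have q1 : β * r = 0 := by linarith
    have q2 : γ * (s * r) = 0 := by linarith
    have q3 : α = 0 := by linarith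
    have q1' : β = 0 := by simpa [hr.ne'] using q1
    have q2' : γ = 0 := by simpa [hr.ne', hs.ne'] using q2
    linarith
  · exact ha h

/-- twice the signed area of a triangle. -/
def auxO (P Q R : ℝ × ℝ) : ℝ := (Q.1 - P.1) * (R.2 - P.2) - (Q.2 - P.2) * (R.1 - P.1)

lemma aux_quad_nonneg {S : Set (ℝ × ℝ)} [SimplyConnectedSpace S] {P Q R T : ℝ × ℝ}
    (hPQ : segment ℝ P Q ⊆ S) (hQR : segment ℝ Q R ⊆ S)
    (hPT : segment ℝ P T ⊆ S) (hTR : segment ℝ T R ⊆ S)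
    (o1 : 0 ≤ auxO P Q R) (o2 : 0 ≤ auxO P R T)
    {α β γ : ℝ} (hα : 0 ≤ α) (hβ : 0 ≤ β) (hγ : 0 ≤ γ) (h1 : α + β + γ = 1) :
    α • P + β • Q + γ • R ∈ S := by
  by_contra hp
  refine aux_complex (aux_seg_slit hp hPQ) (aux_seg_slit hp hQR) (aux_seg_slit hp hPT)
    (aux_seg_slit hp hTR) (aux_arg_sum hp hPQ hQR hPT hTR) hα hβ hγ h1 ?_ ?_ ?_
  · have e : α = 1 - β - γ := by linarith
    apply Complex.ext <;> simp [auxZ] <;> rw [e] <;> ring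
  · have : auxO P Q R = _ := rfl
    convert o1 using 1
    simp only [auxZ, auxO]; ring
  · convert o2 using 1
    simp only [auxZ, auxO]; ring

lemma aux_quad {S : Set (ℝ × ℝ)} [SimplyConnectedSpace S] {P Q R T : ℝ × ℝ}
    (hPQ : segment ℝ P Q ⊆ S) (hQR : segment ℝ Q R ⊆ S)
    (hPT : segment ℝ P T ⊆ S) (hTR : segment ℝ T R ⊆ S)
    (o : 0 ≤ auxO P Q R * auxO P R T)
    {α β γ : ℝ} (hα : 0 ≤ α) (hβ : 0 ≤ β) (hγ : 0 ≤ γ) (h1 : α + β + γ = 1) :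
    α • P + β • Q + γ • R ∈ S := by
  have e1 : auxO R Q P = - auxO P Q R := by simp only [auxO]; ring
  have e2 : auxO R P T = - auxO P R T := by simp only [auxO]; ring
  rcases mul_nonneg_iff.mp o with ⟨a, b⟩ | ⟨a, b⟩
  · exact aux_quad_nonneg hPQ hQR hPT hTR a b hα hβ hγ h1
  · have := aux_quad_nonneg (P := R) (Q := Q) (R := P) (T := T) (segment_symm ℝ Q R ▸ hQR)
      (segment_symm ℝ P Q ▸ hPQ) (segment_symm ℝ T R ▸ hTR) (segment_symm ℝ P T ▸ hPT)
      (by linarith) (by linarith) hγ hβ hα (by linarith)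
    convert this using 1
    abel

/-- A point of `[P, Q]` sees `R` through the triangle `P Q R`. -/
lemma aux_see {S : Set (ℝ × ℝ)} [SimplyConnectedSpace S] {P Q R T : ℝ × ℝ}
    (hPQ : segment ℝ P Q ⊆ S) (hQR : segment ℝ Q R ⊆ S)
    (hPT : segment ℝ P T ⊆ S) (hTR : segment ℝ T R ⊆ S)
    (o : 0 ≤ auxO P Q R * auxO P R T) {s t : ℝ} (hs : 0 ≤ s) (ht : 0 ≤ t) (hst : s + t = 1) :
    segment ℝ (s • P + t • Q) R ⊆ S := by
  rintro _ ⟨u, v, hu, hv, huv, rfl⟩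
  have := aux_quad hPQ hQR hPT hTR o (mul_nonneg hu hs) (mul_nonneg hu ht) hv
    (by rw [← mul_add, hst, mul_one, huv])
  convert this using 1
  module

lemma aux_cross {X₁ X₂ Y₁ Y₂ : ℝ × ℝ} (h1 : auxO X₁ X₂ Y₁ * auxO X₁ X₂ Y₂ < 0)
    (h2 : auxO Y₁ Y₂ X₁ * auxO Y₁ Y₂ X₂ < 0) :
    ∃ u v : ℝ, 0 < u ∧ u < 1 ∧ 0 < v ∧ v < 1 ∧
      (1 - u) • X₁ + u • X₂ = (1 - v) • Y₁ + v • Y₂ := by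
  have key : ∀ a b : ℝ, a * b < 0 → a - b ≠ 0 ∧ 0 < a / (a - b) ∧ a / (a - b) < 1 := by
    intro a b hab
    rcases mul_neg_iff.mp hab with ⟨ha, hb⟩ | ⟨ha, hb⟩
    · refine ⟨by linarith, div_pos ha (by linarith), ?_⟩
      rw [div_lt_one (by linarith)]; linarith
    · refine ⟨by linarith, div_pos_of_neg_of_neg ha (by linarith), ?_⟩
      rw [div_lt_one_of_neg (by linarith)]; linarith
  obtain ⟨n1, p1, q1⟩ := key _ _ h1
  obtain ⟨n2, p2, q2⟩ := key _ _ h2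
  refine ⟨_, _, p2, q2, p1, q1, ?_⟩
  have hD : auxO X₁ X₂ Y₁ - auxO X₁ X₂ Y₂ = -(auxO Y₁ Y₂ X₁ - auxO Y₁ Y₂ X₂) := by
    simp only [auxO]; ring
  rw [hD]
  ext
  · simp only [Prod.fst_add, Prod.smul_fst, smul_eq_mul]
    field_simp
    simp only [auxO]; ring
  · simp only [Prod.snd_add, Prod.smul_snd, smul_eq_mul]
    field_simp
    simp only [auxO]; ring

lemma aux_crossing {S : Set (ℝ × ℝ)} [SimplyConnectedSpace S] {A₁ A₂ B₁ B₂ : ℝ × ℝ}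
    (hA : segment ℝ A₁ A₂ ⊆ S) (hB : segment ℝ B₁ B₂ ⊆ S)
    (h1 : segment ℝ A₁ B₁ ⊆ S) (h2 : segment ℝ A₂ B₂ ⊆ S)
    {u v : ℝ} (hu : 0 < u) (hu1 : u < 1) (hv : 0 < v) (hv1 : v < 1)
    (huv : (1 - u) • A₁ + u • B₁ = (1 - v) • A₂ + v • B₂)
    {s t : ℝ} (hs : 0 ≤ s) (ht : 0 ≤ t) (hst : s + t = 1) :
    ∃ B ∈ segment ℝ B₁ B₂, segment ℝ (s • A₁ + t • A₂) B ⊆ S := by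
  set C := (1 - u) • A₁ + u • B₁ with hC
  have hC1 : C ∈ segment ℝ A₁ B₁ := ⟨1 - u, u, by linarith, hu.le, by ring, rfl⟩
  have hC2 : C ∈ segment ℝ A₂ B₂ := ⟨1 - v, v, by linarith, hv.le, by ring, huv.symm⟩
  have sub : ∀ {X Y P Q : ℝ × ℝ}, segment ℝ X Y ⊆ S → P ∈ segment ℝ X Y → Q ∈ segment ℝ X Y →
      segment ℝ P Q ⊆ S := fun h hp hq => ((convex_segment _ _).segment_subset hp hq).trans h
  have seeA : segment ℝ (s • A₁ + t • A₂) C ⊆ S :=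
    aux_see (T := C) hA (sub h2 (left_mem_segment _ _ _) hC2) (sub h1 (left_mem_segment _ _ _) hC1)
      (sub h1 hC1 hC1) (le_of_eq (by simp only [auxO]; ring)) hs ht hst
  -- the opposite point
  set m := s * u * (1 - v) + t * v * (1 - u) with hm
  have hmpos : 0 < m := by
    rcases hs.eq_or_lt with h | h
    · have : t = 1 := by linarith
      subst h this; simp only [hm]
      have : 0 < v * (1 - u) := mul_pos hv (by linarith)
      linarith
    · have a1 : 0 < s * u * (1 - v) := mul_pos (mul_pos h hu) (by linarith)
      have a2 : 0 ≤ t * v * (1 - u) := mul_nonneg (mul_nonneg ht hv.le) (by linarith)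
      linarith
  set s' := s * u * (1 - v) / m with hs'
  set t' := t * v * (1 - u) / m with ht'
  have hs'0 : 0 ≤ s' := div_nonneg (mul_nonneg (mul_nonneg hs hu.le) (by linarith)) hmpos.le
  have ht'0 : 0 ≤ t' := div_nonneg (mul_nonneg (mul_nonneg ht hv.le) (by linarith)) hmpos.le
  have hst' : s' + t' = 1 := by rw [hs', ht', ← add_div, div_self hmpos.ne']
  refine ⟨s' • B₁ + t' • B₂, ⟨s', t', hs'0, ht'0, hst', rfl⟩, ?_⟩
  have seeB : segment ℝ (s' • B₁ + t' • B₂) C ⊆ S :=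
    aux_see (T := C) hB (sub h2 (right_mem_segment _ _ _) hC2)
      (sub h1 (right_mem_segment _ _ _) hC1)
      (sub h1 hC1 hC1) (le_of_eq (by simp only [auxO]; ring)) hs'0 ht'0 hst'
  have hCm : C ∈ segment ℝ (s • A₁ + t • A₂) (s' • B₁ + t' • B₂) := by
    have hk : 0 < m + (1 - u) * (1 - v) := by nlinarith
    refine ⟨(1 - u) * (1 - v) / (m + (1 - u) * (1 - v)), m / (m + (1 - u) * (1 - v)),
      div_nonneg (by nlinarith) hk.le, div_nonneg hmpos.le hk.le, by
        rw [← add_div, add_comm, div_self hk.ne'], ?_⟩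
    have ht1 : t = 1 - s := by linarith
    have fst : ∀ a1 a2 b1 b2 : ℝ, (1 - u) * a1 + u * b1 = (1 - v) * a2 + v * b2 →
        (1 - u) * (1 - v) / (m + (1 - u) * (1 - v)) * (s * a1 + t * a2) +
        m / (m + (1 - u) * (1 - v)) * (s' * b1 + t' * b2) = (1 - u) * a1 + u * b1 := by
      intro a1 a2 b1 b2 h
      rw [hs', ht']
      field_simp
      rw [hm, ht1]
      linear_combination (-(1-s) * (1-u)) * h
    ext
    · have := fst A₁.1 A₂.1 B₁.1 B₂.1 (by simpa [hC] using congrArg Prod.fst huv)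
      simpa [hC, mul_add] using this
    · have := fst A₁.2 A₂.2 B₁.2 B₂.2 (by simpa [hC] using congrArg Prod.snd huv)
      simpa [hC, mul_add] using this
  intro x hx
  rcases aux_split hCm hx with h | h
  · exact seeA h
  · exact seeB (segment_symm ℝ C _ ▸ h)

/-- If `S ⊆ ℝ²` is simply connected and `ℓ, ℓ'` are line segments in `S`,
then `vis(ℓ',S) ∩ ℓ` is convex (hence a possibly empty subsegment of `ℓ`). -/
theorem vis_inter_segment_convex (S ℓ ℓ' : Set (ℝ × ℝ))
    (hS : SimplyConnectedSpace S)
    (hℓ : IsLineSegment ℓ) (hℓ' : IsLineSegment ℓ')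
    (hℓS : ℓ ⊆ S) (hℓ'S : ℓ' ⊆ S) :
    Convex ℝ ({A | A ∈ S ∧ ∃ B ∈ ℓ', segment ℝ A B ⊆ S} ∩ ℓ) := by
  rintro A₁ ⟨⟨-, B₁, hB₁, h1⟩, hA₁⟩ A₂ ⟨⟨-, B₂, hB₂, h2⟩, hA₂⟩ s t hs ht hst
  have hAl : s • A₁ + t • A₂ ∈ ℓ := hℓ.1 hA₁ hA₂ hs ht hst
  refine ⟨⟨hℓS hAl, ?_⟩, hAl⟩
  have hA : segment ℝ A₁ A₂ ⊆ S := (hℓ.1.segment_subset hA₁ hA₂).trans hℓS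
  have hBl : segment ℝ B₁ B₂ ⊆ ℓ' := hℓ'.1.segment_subset hB₁ hB₂
  have hB : segment ℝ B₁ B₂ ⊆ S := hBl.trans hℓ'S
  have hA' : segment ℝ A₂ A₁ ⊆ S := segment_symm ℝ A₁ A₂ ▸ hA
  have hB' : segment ℝ B₂ B₁ ⊆ S := segment_symm ℝ B₁ B₂ ▸ hB
  by_cases c1 : 0 ≤ auxO A₁ A₂ B₂ * auxO A₁ B₂ B₁
  · exact ⟨B₂, hB₂, aux_see hA h2 h1 hB c1 hs ht hst⟩
  by_cases c2 : 0 ≤ auxO A₂ A₁ B₁ * auxO A₂ B₁ B₂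
  · refine ⟨B₁, hB₁, ?_⟩
    rw [add_comm]
    exact aux_see hA' h1 h2 hB' c2 ht hs (by linarith)
  push Not at c1 c2
  have e1 : auxO A₁ B₁ A₂ = auxO A₂ A₁ B₁ := by simp only [auxO]; ring
  have e2 : auxO A₁ B₁ B₂ = - auxO A₁ B₂ B₁ := by simp only [auxO]; ring
  have e3 : auxO A₂ B₂ A₁ = auxO A₁ A₂ B₂ := by simp only [auxO]; ring
  have e4 : auxO A₂ B₂ B₁ = - auxO A₂ B₁ B₂ := by simp only [auxO]; ring
  have e5 : auxO A₁ A₂ B₁ = - auxO A₂ A₁ B₁ := by simp only [auxO]; ring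
  have e6 : auxO B₁ B₂ A₁ = - auxO A₁ B₂ B₁ := by simp only [auxO]; ring
  have e7 : auxO B₁ B₂ A₂ = auxO A₂ B₁ B₂ := by simp only [auxO]; ring
  by_cases c3 : auxO A₁ A₂ B₂ * auxO A₂ A₁ B₁ < 0
  · -- the connecting segments cross
    obtain ⟨u, v, hu, hu1, hv, hv1, huv⟩ := aux_cross (X₁ := A₁) (X₂ := B₁) (Y₁ := A₂) (Y₂ := B₂)
      (by
        rw [e1, e2]
        rcases mul_neg_iff.mp c1 with ⟨a, b⟩ | ⟨a, b⟩ <;>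
        rcases mul_neg_iff.mp c3 with ⟨a', b'⟩ | ⟨a', b'⟩ <;> nlinarith)
      (by
        rw [e3, e4]
        rcases mul_neg_iff.mp c2 with ⟨a, b⟩ | ⟨a, b⟩ <;>
        rcases mul_neg_iff.mp c3 with ⟨a', b'⟩ | ⟨a', b'⟩ <;> nlinarith)
    obtain ⟨B, hBm, hsee⟩ := aux_crossing hA hB h1 h2 hu hu1 hv hv1 huv hs ht hst
    exact ⟨B, hBl hBm, hsee⟩
  · -- the segments `ℓ` and `ℓ'` cross
    have c3' : 0 < auxO A₁ A₂ B₂ * auxO A₂ A₁ B₁ := by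
      refine lt_of_le_of_ne (not_lt.mp c3) (Ne.symm (mul_ne_zero ?_ ?_))
      · rintro h; rw [h] at c1; simp at c1
      · rintro h; rw [h] at c2; simp at c2
    obtain ⟨u, v, hu, hu1, hv, hv1, huv⟩ := aux_cross (X₁ := A₁) (X₂ := A₂) (Y₁ := B₁) (Y₂ := B₂)
      (by rw [e5]; linarith)
      (by
        rw [e6, e7]
        rcases mul_neg_iff.mp c1 with ⟨a, b⟩ | ⟨a, b⟩ <;>
        rcases mul_neg_iff.mp c2 with ⟨a', b'⟩ | ⟨a', b'⟩ <;> nlinarith)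
    have m1 : (1 - u) • A₁ + u • A₂ ∈ ℓ := hℓ.1 hA₁ hA₂ (by linarith) hu.le (by ring)
    have m2 : (1 - u) • A₁ + u • A₂ ∈ ℓ' := by
      rw [huv]; exact hℓ'.1 hB₁ hB₂ (by linarith) hv.le (by ring)
    exact ⟨_, m2, (hℓ.1.segment_subset hAl m1).trans hℓS⟩
end

section
/- For every positive integer n, every dimension d ≥ 2, and every n-point set N ⊆ (0,1)ᵈ, the set S = (0,1)ᵈ \ N satisfies b_d(S) ≥ 1/(2n). -/
open MeasureTheory
open scoped ENNReal

theorem cs_label {E : Type*} [MeasurableSpace E] (μ : Measure E) [IsProbabilityMeasure μ]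
    (L : E → ℕ) (hL : Measurable L) (m : ℕ) (hm : 0 < m) (hlt : ∀ x, L x < m) :
    (1 : ℝ≥0∞) / m ≤ (μ.prod μ) {p | L p.1 = L p.2} := by
  have hset : {p : E × E | L p.1 = L p.2} =
      ⋃ l ∈ Finset.range m, (L ⁻¹' {l}) ×ˢ (L ⁻¹' {l}) := by
    ext p
    simp only [Set.mem_ofPred_eq, Set.mem_iUnion, Set.mem_prod, Set.mem_preimage,
      Set.mem_singleton_iff, Finset.mem_range, exists_prop]
    exact ⟨fun h => ⟨L p.2, hlt _, h, rfl⟩, fun ⟨l, _, h1, h2⟩ => h1.trans h2.symm⟩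
  have hms : ∀ l, MeasurableSet (L ⁻¹' {l}) := fun l => hL (measurableSet_singleton l)
  have hdisj : ∀ i j, i ≠ j → Disjoint (L ⁻¹' {i}) (L ⁻¹' {j}) := fun i j hij =>
    Disjoint.preimage _ (by simpa using hij)
  rw [hset, measure_biUnion_finset]
  rotate_left
  · intro i _ j _ hij
    exact Set.disjoint_prod.2 (Or.inl (hdisj i j hij))
  · exact fun l _ => (hms l).prod (hms l)
  have h1 : ∑ l ∈ Finset.range m, μ (L ⁻¹' {l}) = 1 := by
    rw [← measure_biUnion_finset (fun i _ j _ hij => hdisj i j hij) (fun l _ => hms l)]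
    convert measure_univ (μ := μ)
    ext x
    simpa using hlt x
  have h1' : ∑ l ∈ Finset.range m, (μ (L ⁻¹' {l})).toReal = 1 := by
    rw [← ENNReal.toReal_sum (fun _ _ => measure_ne_top _ _), h1]; simp
  have h2 := sq_sum_le_card_mul_sum_sq (s := Finset.range m) (f := fun l => (μ (L ⁻¹' {l})).toReal)
  rw [h1', Finset.card_range] at h2
  have h3 : ∑ l ∈ Finset.range m, (μ.prod μ) ((L ⁻¹' {l}) ×ˢ (L ⁻¹' {l})) =
      ENNReal.ofReal (∑ l ∈ Finset.range m, (μ (L ⁻¹' {l})).toReal ^ 2) := by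
    rw [ENNReal.ofReal_sum_of_nonneg (fun _ _ => by positivity)]
    refine Finset.sum_congr rfl fun l _ => ?_
    rw [Measure.prod_prod, sq, ENNReal.ofReal_mul ENNReal.toReal_nonneg,
      ENNReal.ofReal_toReal (measure_ne_top _ _)]
  rw [h3]
  have hm' : (0:ℝ) < m := by exact_mod_cast hm
  have : (1 : ℝ≥0∞) / m = ENNReal.ofReal (1 / m) := by
    rw [ENNReal.ofReal_div_of_pos hm']; simp
  rw [this]
  apply ENNReal.ofReal_le_ofReal
  rw [div_le_iff₀ hm']
  linarith

theorem hyper_null {d : ℕ} (φ : (Fin d → ℝ) →ₗ[ℝ] ℝ) (hφ : φ ≠ 0) (c : ℝ) :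
    volume {x : Fin d → ℝ | φ x = c} = 0 := by
  by_cases hex : ∃ x0, φ x0 = c
  · obtain ⟨x0, hx0⟩ := hex
    have : {x : Fin d → ℝ | φ x = c} = (fun x => x + (-x0)) ⁻¹' (LinearMap.ker φ : Set (Fin d → ℝ)) := by
      ext x; simp [← sub_eq_add_neg, sub_eq_zero, hx0]
    rw [this, measure_preimage_add_right]
    exact Measure.addHaar_submodule _ _ (by simpa [LinearMap.ker_eq_top] using hφ)
  · push Not at hex
    simp [hex]

theorem indep_null {d : ℕ} (q : Fin d → ℝ) (k : ℕ) (hk : k ≤ d) :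
    volume {B : Fin k → (Fin d → ℝ) | ¬ LinearIndependent ℝ (fun i => B i - q)} = 0 := by
  induction k with
  | zero => simp
  | succ k ih =>
    have ih := ih (by omega)
    have hmeas : ∀ k : ℕ, MeasurableSet
        {B : Fin k → (Fin d → ℝ) | ¬ LinearIndependent ℝ (fun i => B i - q)} := by
      intro k
      have h : IsOpen {B : Fin k → (Fin d → ℝ) | LinearIndependent ℝ B} :=
        isOpen_setOfPred_linearIndependent
      have hc : Continuous fun B : Fin k → (Fin d → ℝ) => fun i => B i - q := by fun_prop
      exact (h.preimage hc).measurableSet.compl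
    have hmp := (volume_preserving_piFinSuccAbove (fun _ : Fin (k+1) => (Fin d → ℝ)) 0).symm
    rw [← hmp.measure_preimage (hmeas _).nullMeasurableSet, Measure.volume_eq_prod,
      ← Measure.prod_swap, Measure.map_apply measurable_swap (hmp.measurable (hmeas _)),
      Measure.measure_prod_null (measurable_swap (hmp.measurable (hmeas _)))]
    have : ∀ᵐ B : Fin k → (Fin d → ℝ), LinearIndependent ℝ (fun i => B i - q) := by
      rw [ae_iff]; exact ih
    filter_upwards [this] with B hB
    have hs : Submodule.span ℝ (Set.range fun i => B i - q) ≠ ⊤ := by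
      intro h
      have h1 := finrank_range_le_card (R := ℝ) (fun i => B i - q)
      rw [Set.finrank, h, finrank_top] at h1
      simp at h1
      omega
    have h0 := Measure.addHaar_submodule volume _ hs
    rw [← measure_preimage_add_right volume (-q)] at h0
    refine measure_mono_null ?_ h0
    intro x hx
    by_contra hn
    refine hx ?_
    rw [Set.mem_preimage, ← sub_eq_add_neg] at hn
    have := linearIndependent_finCons.2 ⟨hB, hn⟩
    have heq : (fun i => (MeasurableEquiv.piFinSuccAbove (fun _ : Fin (k+1) => (Fin d → ℝ)) 0).symm
        (x, B) i - q) = (Fin.cons (x - q) (fun i => B i - q) : Fin (k+1) → (Fin d → ℝ)) := by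
      funext i
      refine Fin.cases ?_ (fun j => ?_) i <;> simp [MeasurableEquiv.piFinSuccAbove]
    rw [← heq] at this
    exact this

/-- The affine functionals `G = g - g(q1)` and `H = h - h(B 0)`. -/
theorem exists_functionals {m : ℕ} (N : Finset (Fin (m+2) → ℝ)) (q1 : Fin (m+2) → ℝ)
    (B : Fin (m+1) → (Fin (m+2) → ℝ))
    (hB : ∀ q ∈ N, LinearIndependent ℝ (fun i => B i - q)) :
    ∃ g h : (Fin (m+2) → ℝ) →ₗ[ℝ] ℝ, g ≠ 0 ∧ (∀ i, g (B i) = g q1) ∧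
      (∀ i, h (B i) = h (B 0)) ∧ ∀ q ∈ N, h q ≠ h (B 0) := by
  have hlt : Submodule.span ℝ (Set.range fun i => B i - q1) < ⊤ := by
    rw [lt_top_iff_ne_top]
    intro h
    have h1 := finrank_range_le_card (R := ℝ) (fun i => B i - q1)
    rw [Set.finrank, h, finrank_top] at h1
    simp at h1
  obtain ⟨g, hg0, hg⟩ := Submodule.exists_le_ker_of_lt_top _ hlt
  have hgB : ∀ i, g (B i) = g q1 := fun i => by
    have := hg (Submodule.subset_span ⟨i, rfl⟩)
    rw [LinearMap.mem_ker, map_sub] at this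
    linarith
  let P : Submodule ℝ (Module.Dual ℝ (Fin (m+2) → ℝ)) :=
    (Submodule.span ℝ (Set.range fun i => B i - B 0)).dualAnnihilator
  have hP : ∀ h : Module.Dual ℝ (Fin (m+2) → ℝ), h ∈ P ↔ ∀ i, h (B i) = h (B 0) := by
    intro h
    simp only [P, Submodule.mem_dualAnnihilator]
    constructor
    · intro H i
      have := H _ (Submodule.subset_span ⟨i, rfl⟩)
      simp only [map_sub] at this
      linarith
    · intro H w hw
      have : Submodule.span ℝ (Set.range fun i => B i - B 0) ≤ LinearMap.ker h := by
        rw [Submodule.span_le]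
        rintro _ ⟨i, rfl⟩
        simp [H i]
      exact this hw
  obtain ⟨h, hhP, hh⟩ := Module.Dual.exists_forall_mem_ne_zero_of_forall_exists P
    (fun q : N => Module.Dual.eval ℝ (Fin (m+2) → ℝ) (q.1 - B 0)) (by
      rintro ⟨q, hq⟩
      obtain ⟨h, hh⟩ : ∃ h : (Fin (m+2) → ℝ) →ₗ[ℝ] ℝ, ∀ i, h (B i - q) = 1 := by
        let b := Module.Basis.span (hB q hq)
        obtain ⟨h, hh⟩ := (b.constr ℝ (fun _ => (1:ℝ))).exists_extend
        refine ⟨h, fun i => ?_⟩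
        have h1 := LinearMap.congr_fun hh (b i)
        rw [Module.Basis.constr_basis] at h1
        rw [← h1]
        simp [b, Module.Basis.span_apply]
      have h2 : ∀ i, h (B i) = 1 + h q := fun i => by
        have := hh i
        rw [map_sub] at this
        linarith
      refine ⟨h, (hP h).2 fun i => by rw [h2, h2], ?_⟩
      simp [h2])
  refine ⟨g, h, hg0, hgB, (hP h).1 hhP, fun q hq => ?_⟩
  have := hh ⟨q, hq⟩
  simpa [sub_eq_zero] using this

theorem same_side (gx gy gq hx hy hq : ℝ) (h0 : gx ≠ 0) (h1 : gy ≠ 0)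
    (hg : 0 < gx ↔ 0 < gy) (hxq : hx * gq - hq * gx ≠ 0) (hyq : hy * gq - hq * gy ≠ 0)
    (ht : gq ≠ 0 → (hq / gq < hx / gx ↔ hq / gq < hy / gy)) :
    0 < (hx * gq - hq * gx) * (hy * gq - hq * gy) := by
  have hgg : 0 < gx * gy := by
    rcases lt_or_gt_of_ne h0 with h | h
    · have : gy < 0 := lt_of_le_of_ne (not_lt.1 (fun hc => absurd (hg.2 hc) (not_lt.2 h.le))) h1
      exact mul_pos_of_neg_of_neg h this
    · exact mul_pos h (hg.1 h)
  by_cases hq0 : gq = 0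
  · subst hq0
    have : hq ≠ 0 := by rintro rfl; simp at hxq
    have : 0 < hq ^ 2 := by positivity
    nlinarith [mul_pos this hgg]
  · have ht := ht hq0
    have e1 : hx * gq - hq * gx = gx * gq * (hx / gx - hq / gq) := by field_simp
    have e2 : hy * gq - hq * gy = gy * gq * (hy / gy - hq / gq) := by field_simp
    rw [e1] at hxq ⊢
    rw [e2] at hyq ⊢
    have n1 : hx / gx - hq / gq ≠ 0 := right_ne_zero_of_mul hxq
    have n2 : hy / gy - hq / gq ≠ 0 := right_ne_zero_of_mul hyq
    have hp : 0 < (hx / gx - hq / gq) * (hy / gy - hq / gq) := by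
      rcases lt_or_gt_of_ne n1 with h | h
      · have : hy / gy - hq / gq < 0 := by
          refine lt_of_le_of_ne (not_lt.1 fun hc => ?_) n2
          have := ht.2 (by linarith)
          linarith
        exact mul_pos_of_neg_of_neg h this
      · have := ht.1 (by linarith)
        exact mul_pos h (by linarith)
    have hq2 : 0 < gq ^ 2 := by positivity
    have := mul_pos (mul_pos hgg hq2) hp
    calc 0 < _ := this
      _ = _ := by ring

/-- If `f` is affine (linear part `φ`), kills `q` and the `B i`, and `a0, a1` lie strictly on the
same side, then `q` is not in the hull. -/
theorem not_mem_hull {E : Type*} [AddCommGroup E] [Module ℝ E] {k : ℕ} (B : Fin k → E) (a0 a1 q : E)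
    (φ h : E →ₗ[ℝ] ℝ) (c c' : ℝ) (hφB : ∀ i, φ (B i) = c) (hφq : φ q = c)
    (hhB : ∀ i, h (B i) = c') (hhq : h q ≠ c') (hs : 0 < (φ a0 - c) * (φ a1 - c)) :
    q ∉ convexHull ℝ (Set.range (Fin.cons a0 (Fin.cons a1 B : Fin (k+1) → E) : Fin (k+2) → E)) := by
  wlog hpos : 0 < φ a0 - c generalizing φ c
  · refine this (-φ) (-c) (fun i => by simp [hφB]) (by simp [hφq]) ?_ ?_
    · simp only [LinearMap.neg_apply]; nlinarith
    · simp only [LinearMap.neg_apply]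
      have : φ a0 - c ≠ 0 := left_ne_zero_of_mul hs.ne'
      have := lt_of_le_of_ne (not_lt.1 hpos) this
      linarith
  have hpos1 : 0 < φ a1 - c := by
    exact (pos_iff_pos_of_mul_pos hs).1 hpos
  intro hq
  let K : Set E := {x | c < φ x ∨ (φ x = c ∧ h x = c')}
  have hK : Convex ℝ K := by
    intro x hx y hy a b ha hb hab
    have hb' : b = 1 - a := by linarith
    simp only [K, Set.mem_ofPred_eq, map_add, map_smul, smul_eq_mul] at hx hy ⊢
    rcases ha.eq_or_lt with rfl | ha
    · have : b = 1 := by linarith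
      subst this; simpa using hy
    rcases hb.eq_or_lt with hb0 | hb
    · have : a = 1 := by linarith
      subst this; rw [← hb0]; simpa using hx
    rcases hx with hx | ⟨hx, hx'⟩ <;> rcases hy with hy | ⟨hy, hy'⟩
    · left; subst hb'; nlinarith [mul_lt_mul_of_pos_left hx ha, mul_lt_mul_of_pos_left hy hb]
    · left; subst hb'; nlinarith
    · left; subst hb'; nlinarith
    · right; rw [hx, hx', hy, hy']; subst hb'; constructor <;> ring
  have hsub : Set.range (Fin.cons a0 (Fin.cons a1 B : Fin (k+1) → E) : Fin (k+2) → E) ⊆ K := by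
    rintro _ ⟨i, rfl⟩
    refine Fin.cases ?_ (fun j => ?_) i
    · left; simp only [Fin.cons_zero]; linarith
    · refine Fin.cases ?_ (fun j => ?_) j
      · left; simp only [Fin.cons_zero, Fin.cons_succ]; linarith
      · right; simp [hφB, hhB]
  rcases convexHull_min hsub hK hq with h1 | h1
  · rw [hφq] at h1; exact lt_irrefl _ h1
  · exact hhq h1.2

/-- The open unit cube. -/
def ucube (d : ℕ) : Set (Fin d → ℝ) := {x : Fin d → ℝ | ∀ i, x i ∈ Set.Ioo (0:ℝ) 1}

theorem ucube_eq (d : ℕ) : ucube d = Set.pi Set.univ (fun _ => Set.Ioo (0:ℝ) 1) := by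
  ext x; simp [ucube]

theorem ucube_meas (d : ℕ) : MeasurableSet (ucube d) := by
  rw [ucube_eq]; exact MeasurableSet.univ_pi fun _ => measurableSet_Ioo

theorem ucube_vol (d : ℕ) : volume (ucube d) = 1 := by
  rw [ucube_eq, volume_pi_pi]; simp

theorem ucube_convex (d : ℕ) : Convex ℝ (ucube d) := by
  rw [ucube_eq]; exact convex_pi fun _ _ => convex_Ioo _ _

theorem section_bound {m : ℕ} (N : Finset (Fin (m+2) → ℝ)) (hn : 0 < N.card)
    (B : Fin (m+1) → (Fin (m+2) → ℝ)) (hBc : ∀ i, B i ∈ ucube (m+2))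
    (hB : ∀ q ∈ N, LinearIndependent ℝ (fun i => B i - q)) :
    (1 : ℝ≥0∞) / ((2 * N.card : ℕ) : ℝ≥0∞) ≤ (volume.prod volume)
      {p : (Fin (m+2) → ℝ) × (Fin (m+2) → ℝ) |
      convexHull ℝ (Set.range (Fin.cons p.1 (Fin.cons p.2 B : Fin (m+2) → (Fin (m+2) → ℝ)) :
        Fin (m+3) → (Fin (m+2) → ℝ))) ⊆ ucube (m+2) \ ↑N} := by
  classical
  obtain ⟨q1, hq1⟩ := Finset.card_pos.1 hn
  obtain ⟨g, h, hg0, hgB, hhB, hhN⟩ := exists_functionals N q1 B hB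
  set G : (Fin (m+2) → ℝ) → ℝ := fun x => g x - g q1 with hG
  set H : (Fin (m+2) → ℝ) → ℝ := fun x => h x - h (B 0) with hH
  have hGm : Measurable G := (g.continuous_of_finiteDimensional.sub continuous_const).measurable
  have hHm : Measurable H := (h.continuous_of_finiteDimensional.sub continuous_const).measurable
  let φ : (Fin (m+2) → ℝ) → ((Fin (m+2) → ℝ) →ₗ[ℝ] ℝ) := fun q => G q • h - H q • g
  have hφ : ∀ q x, φ q x - φ q (B 0) = H x * G q - H q * G x := by
    intro q x
    simp only [φ, hG, hH, LinearMap.sub_apply, LinearMap.smul_apply, smul_eq_mul, hgB]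
    ring
  have hφ0 : ∀ q ∈ N, φ q ≠ 0 := by
    intro q hq h0
    have h1 := hφ q q1
    rw [h0] at h1
    have hGq1 : G q1 = 0 := by simp [hG]
    have hHq1 : H q1 ≠ 0 := sub_ne_zero.2 (hhN q1 hq1)
    have hHq : H q ≠ 0 := sub_ne_zero.2 (hhN q hq)
    rw [hGq1] at h1
    have hGq : G q = 0 := by
      have : H q1 * G q = 0 := by simpa using h1.symm
      exact (mul_eq_zero.1 this).resolve_left hHq1
    simp only [φ, hGq, zero_smul, zero_sub, neg_eq_zero, smul_eq_zero] at h0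
    exact h0.elim hHq hg0
  let Z : Set (Fin (m+2) → ℝ) := {x | g x = g q1} ∪ ⋃ q ∈ N, {x | φ q x = φ q (B 0)}
  have hZ : volume Z = 0 := by
    refine measure_union_null (hyper_null g hg0 _) ?_
    refine (measure_biUnion_null_iff N.countable_toSet).2 ?_
    exact fun q hq => hyper_null _ (hφ0 q hq) _
  let C := ucube (m+2) \ Z
  have hC : volume C = 1 := by
    rw [measure_sdiff_null hZ, ucube_vol]
  have : IsProbabilityMeasure (volume.restrict C) := ⟨by simp [hC]⟩
  let F : (Fin (m+2) → ℝ) → Finset (Fin (m+2) → ℝ) := fun x =>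
    N.filter (fun q => G q ≠ 0 ∧ H q / G q < H x / G x)
  let L : (Fin (m+2) → ℝ) → ℕ := fun x => (F x).card + if 0 < G x then N.card else 0
  have hFlt : ∀ x, (F x).card < N.card := by
    intro x
    refine Finset.card_lt_card ⟨Finset.filter_subset _ _, fun hc => ?_⟩
    have := (Finset.mem_filter.1 (hc hq1)).2.1
    simp [hG] at this
  have hLm : Measurable L := by
    refine Measurable.add ?_ (Measurable.ite (measurableSet_lt measurable_const hGm)
      measurable_const measurable_const)
    simp only [F, Finset.card_filter]
    refine Finset.measurable_sum _ fun q _ => ?_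
    refine Measurable.ite ?_ measurable_const measurable_const
    exact (MeasurableSet.const _).inter (measurableSet_lt measurable_const (hHm.div hGm))
  have hLlt : ∀ x, L x < 2 * N.card := by
    intro x
    have := hFlt x
    simp only [L]
    split_ifs <;> omega
  refine (cs_label (volume.restrict C) L hLm (2 * N.card) (by omega) hLlt).trans ?_
  have hms : MeasurableSet {p : (Fin (m+2) → ℝ) × (Fin (m+2) → ℝ) | L p.1 = L p.2} :=
    measurableSet_eq_fun (hLm.comp measurable_fst) (hLm.comp measurable_snd)
  rw [Measure.prod_restrict, Measure.restrict_apply hms]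
  refine measure_mono ?_
  rintro ⟨x, y⟩ ⟨hxy, ⟨hx, hxZ⟩, ⟨hy, hyZ⟩⟩
  simp only [Set.mem_ofPred_eq] at hxy hx hy hxZ hyZ ⊢
  simp only [Z, Set.mem_union, Set.mem_iUnion, Set.mem_ofPred_eq, not_or, not_exists] at hxZ hyZ
  have hsgn : (0 < G x ↔ 0 < G y) ∧ (F x).card = (F y).card := by
    have := hFlt x
    have := hFlt y
    simp only [L] at hxy
    split_ifs at hxy with h1 h2 h2 <;> simp only [h1, h2, true_iff, iff_true] <;>
      first | omega | (refine ⟨Iff.rfl, ?_⟩; omega) | (refine ⟨trivial, ?_⟩; omega)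
  have hFF : F x = F y := by
    rcases le_total (H x / G x) (H y / G y) with hle | hle
    · refine Finset.eq_of_subset_of_card_le ?_ hsgn.2.ge
      intro q hq
      rw [Finset.mem_filter] at hq ⊢
      exact ⟨hq.1, hq.2.1, hq.2.2.trans_le hle⟩
    · refine (Finset.eq_of_subset_of_card_le ?_ hsgn.2.le).symm
      intro q hq
      rw [Finset.mem_filter] at hq ⊢
      exact ⟨hq.1, hq.2.1, hq.2.2.trans_le hle⟩
  refine Set.subset_sdiff.2 ⟨?_, ?_⟩
  · refine convexHull_min ?_ (ucube_convex _)
    rintro _ ⟨i, rfl⟩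
    refine Fin.cases ?_ (fun j => ?_) i
    · simpa using hx
    · refine Fin.cases ?_ (fun j => ?_) j
      · simpa using hy
      · simpa using hBc j
  · rw [Set.disjoint_right]
    intro q hq
    have hq : q ∈ N := hq
    refine not_mem_hull B x y q (φ q) h (φ q (B 0)) (h (B 0)) ?_ ?_ hhB (hhN q hq) ?_
    · intro i
      simp only [φ, LinearMap.sub_apply, LinearMap.smul_apply, hgB, hhB]
    · have := hφ q q
      linarith
    · rw [hφ, hφ]
      refine same_side _ _ _ _ _ _ (sub_ne_zero.2 hxZ.1) (sub_ne_zero.2 hyZ.1) hsgn.1 ?_ ?_ ?_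
      · rw [← hφ]; exact sub_ne_zero.2 (hxZ.2 q hq)
      · rw [← hφ]; exact sub_ne_zero.2 (hyZ.2 q hq)
      · intro hGq
        have h1 : q ∈ F x ↔ q ∈ F y := by rw [hFF]
        simpa [F, hq, hGq] using h1

theorem le_prod_aux {α β : Type*} [MeasurableSpace α] [MeasurableSpace β] (μ : Measure α)
    (ν : Measure β) [SFinite ν] (s : Set (α × β)) :
    ∫⁻ x, ν (Prod.mk x ⁻¹' s) ∂μ ≤ (μ.prod ν) s := by
  rw [← measure_toMeasurable s, Measure.prod_apply (measurableSet_toMeasurable _ _)]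
  exact lintegral_mono fun x => measure_mono (Set.preimage_mono (subset_toMeasurable _ _))

theorem cons_mp (d k : ℕ) : MeasurePreserving
    (fun p : (Fin k → (Fin d → ℝ)) × ((Fin d → ℝ) × (Fin d → ℝ)) =>
      (Fin.cons p.2.1 (Fin.cons p.2.2 p.1 : Fin (k+1) → (Fin d → ℝ)) : Fin (k+2) → (Fin d → ℝ)))
    (volume.prod (volume.prod volume)) volume := by
  have e1 := (volume_preserving_piFinSuccAbove (fun _ : Fin (k+2) => (Fin d → ℝ)) 0).symm
  have e2 := (volume_preserving_piFinSuccAbove (fun _ : Fin (k+1) => (Fin d → ℝ)) 0).symm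
  have e3 := (MeasurePreserving.id (volume : Measure (Fin d → ℝ))).prod e2
  have e4 : MeasurePreserving _ _ _ := measurePreserving_prodAssoc (volume : Measure (Fin d → ℝ))
    (volume : Measure (Fin d → ℝ)) (volume : Measure (Fin k → Fin d → ℝ))
  have e5 := Measure.measurePreserving_swap (μ := (volume : Measure (Fin k → Fin d → ℝ)))
    (ν := (volume : Measure (Fin d → ℝ)).prod (volume : Measure (Fin d → ℝ)))
  have := e1.comp (e3.comp (e4.comp e5))
  refine Eq.subst (motive := fun f => MeasurePreserving f _ _) ?_ this
  funext p i
  refine Fin.cases ?_ (fun j => ?_) i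
  · simp [MeasurableEquiv.piFinSuccAbove, MeasurableEquiv.prodAssoc]
  · refine Fin.cases ?_ (fun j => ?_) j <;>
      simp [MeasurableEquiv.piFinSuccAbove, MeasurableEquiv.prodAssoc]

/-- Removing `n` points from the open unit cube `(0,1)ᵈ` (for `d ≥ 2`)
leaves a set `S` with `b_d(S) ≥ 1/(2n)` (here `λ(S) = 1`). -/
theorem unit_cube_minus_points (d n : ℕ) (hd : 2 ≤ d) (hn : 0 < n)
    (N : Finset (Fin d → ℝ)) (hcard : N.card = n)
    (hN : ↑N ⊆ {x : Fin d → ℝ | ∀ i, x i ∈ Set.Ioo (0:ℝ) 1}) :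
    (1 : ℝ≥0∞) / (2 * n) ≤ volume {A : Fin (d + 1) → (Fin d → ℝ) |
      (∀ i, A i ∈ {x : Fin d → ℝ | ∀ i, x i ∈ Set.Ioo (0:ℝ) 1} \ ↑N) ∧
      convexHull ℝ (Set.range A) ⊆ {x : Fin d → ℝ | ∀ i, x i ∈ Set.Ioo (0:ℝ) 1} \ ↑N} := by
  obtain ⟨m, rfl⟩ : ∃ m, d = m + 2 := ⟨d - 2, by omega⟩
  subst hcard
  have hS : {A : Fin (m + 3) → (Fin (m+2) → ℝ) | convexHull ℝ (Set.range A) ⊆ ucube (m+2) \ ↑N} ⊆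
      {A : Fin (m + 2 + 1) → (Fin (m+2) → ℝ) |
      (∀ i, A i ∈ {x : Fin (m+2) → ℝ | ∀ i, x i ∈ Set.Ioo (0:ℝ) 1} \ ↑N) ∧
      convexHull ℝ (Set.range A) ⊆ {x : Fin (m+2) → ℝ | ∀ i, x i ∈ Set.Ioo (0:ℝ) 1} \ ↑N} :=
    fun A hA => ⟨fun i => hA (subset_convexHull ℝ _ ⟨i, rfl⟩), hA⟩
  refine le_trans ?_ (measure_mono hS)
  refine le_trans ?_ ((cons_mp (m+2) (m+1)).measure_preimage_le _)
  refine le_trans ?_ (le_prod_aux _ _ _)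
  let Q : Set (Fin (m+1) → (Fin (m+2) → ℝ)) := Set.pi Set.univ (fun _ => ucube (m+2))
  have hQm : MeasurableSet Q := MeasurableSet.univ_pi fun _ => ucube_meas _
  have hQ : volume Q = 1 := by
    simp only [Q]
    rw [volume_pi_pi]; simp [ucube_vol]
  have hae : ∀ᵐ B : Fin (m+1) → (Fin (m+2) → ℝ), ∀ q ∈ N,
      LinearIndependent ℝ (fun i => B i - q) := by
    rw [Filter.eventually_all_finset]
    intro q _
    rw [ae_iff]
    exact indep_null q (m+1) (by omega)
  calc (1 : ℝ≥0∞) / (2 * N.card) = ∫⁻ B in Q, (1 : ℝ≥0∞) / ((2 * N.card : ℕ) : ℝ≥0∞) := by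
        rw [setLIntegral_const, hQ]; simp
    _ ≤ ∫⁻ B in Q, _ := ?_
    _ ≤ _ := setLIntegral_le_lintegral Q _
  refine setLIntegral_mono_ae' hQm ?_
  filter_upwards [hae] with B hB hBQ
  exact section_bound N hn B (fun i => hBQ i trivial) hB
end

section
/- For every d ≥ 2 there is a constant β = β(d) > 0 (one may take β = 2^{d-2}(d+1)!) such that every set S ⊆ ℝᵈ for which the d-index of convexity b_d(S) is defined satisfies b_d(S) ≤ β · c(S). -/
open MeasureTheory
open scoped ENNReal

namespace BeerIndex

/-- Matrix whose columns are `e₀` and `a (i+1) - a 0`. -/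
def Q {n : ℕ} (a : Fin (n + 1) → (Fin (n + 1) → ℝ)) : Matrix (Fin (n + 1)) (Fin (n + 1)) ℝ :=
  Matrix.of fun r => Fin.cons (if r = 0 then 1 else 0) fun i : Fin n => a i.succ r - a 0 r

lemma continuous_Q {n : ℕ} : Continuous (Q (n := n)) := by
  refine continuous_pi fun r => continuous_pi fun i => ?_
  refine Fin.cases ?_ (fun i => ?_) i
  · simpa [Q] using continuous_const
  · simp only [Q, Matrix.of_apply, Fin.cons_succ]
    fun_prop

lemma det_Q {n : ℕ} (a : Fin (n + 1) → (Fin (n + 1) → ℝ)) :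
    (Q a).det = (Matrix.of fun r i : Fin n => a i.succ r.succ - a 0 r.succ).det := by
  rw [Matrix.det_succ_column_zero, Finset.sum_eq_single 0]
  · simp [Q]
    rfl
  · intro b _ hb
    simp [Q, hb]
  · simp

lemma ae_det_Q {n : ℕ} :
    ∀ᵐ a : Fin (n + 1) → (Fin (n + 1) → ℝ), (Q a).det ≠ 0 := by
  let v : Fin (n + 1) → (Fin (n + 1) → ℝ) :=
    Fin.cons 0 fun i r => if r = i.succ then 1 else 0
  have hm : MeasurableSet {a : Fin (n + 1) → (Fin (n + 1) → ℝ) | (Q a).det ≠ 0} :=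
    (isOpen_ne_fun (continuous_Q.matrix_det) continuous_const).measurableSet
  refine ae_mem_of_ae_add_linearMap_mem (LinearMap.toSpanSingleton ℝ _ v) volume volume hm ?_
  intro a
  let M : Matrix (Fin n) (Fin n) ℝ := Matrix.of fun r i : Fin n => a i.succ r.succ - a 0 r.succ
  have hfin : (((-M).charpoly.roots.toFinset : Finset ℝ) : Set ℝ).Finite := Finset.finite_toSet _
  have h0 := hfin.measure_zero (volume : Measure ℝ)
  rw [← compl_mem_ae_iff] at h0
  filter_upwards [h0] with t ht
  change (Q (a + LinearMap.toSpanSingleton ℝ _ v t)).det ≠ 0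
  intro h
  apply ht
  simp only [Finset.mem_coe, Multiset.mem_toFinset]
  rw [Polynomial.mem_roots (Matrix.charpoly_monic _).ne_zero, Polynomial.IsRoot.def,
    Matrix.eval_charpoly, ← h, det_Q]
  congr 1
  ext r i
  by_cases hri : r = i
  · subst hri
    simp [M, v]
    ring
  · simp [M, v, hri]

/-- Measure of the slice. -/
lemma slice_le {n : ℕ} (a : Fin (n + 1) → (Fin (n + 1) → ℝ)) (ha : (Q a).det ≠ 0) (K : ℝ)
    (hK : 0 ≤ K) :
    volume {x : Fin (n + 1) → ℝ | (∀ i : Fin n, |(Q a).cramer (x - a 0) i.succ| ≤ |(Q a).det|) ∧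
      |(Q a).cramer (x - a 0) 0| ≤ K} ≤ ENNReal.ofReal (2 ^ (n + 1) * K) := by
  have hD : 0 < |(Q a).det| := abs_pos.2 ha
  let u : Fin (n + 1) → ℝ := Fin.cons (K / |(Q a).det|) fun _ => 1
  have hsub : {x : Fin (n + 1) → ℝ |
      (∀ i : Fin n, |(Q a).cramer (x - a 0) i.succ| ≤ |(Q a).det|) ∧
      |(Q a).cramer (x - a 0) 0| ≤ K} ⊆
      (fun y => a 0 + y) '' (Matrix.toLin' (Q a) '' Set.Icc (-u) u) := by
    rintro x ⟨h1, h2⟩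
    refine ⟨x - a 0, ⟨((Q a).det)⁻¹ • (Q a).cramer (x - a 0), ?_, ?_⟩, by simp⟩
    · have : ∀ i, |(((Q a).det)⁻¹ • (Q a).cramer (x - a 0)) i| ≤ u i := by
        intro i
        rw [Pi.smul_apply, smul_eq_mul, abs_mul, abs_inv, inv_mul_eq_div]
        refine Fin.cases ?_ (fun i => ?_) i
        · exact div_le_div_of_nonneg_right h2 hD.le
        · exact (div_le_one hD).2 (h1 i)
      exact ⟨fun i => (abs_le.1 (this i)).1, fun i => (abs_le.1 (this i)).2⟩
    · rw [map_smul, Matrix.toLin'_apply, Matrix.mulVec_cramer, smul_smul, inv_mul_cancel₀ ha,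
        one_smul]
  refine (measure_mono hsub).trans ?_
  rw [Set.image_add_left, measure_preimage_add, Measure.addHaar_image_linearMap, LinearMap.det_toLin',
    Real.volume_Icc_pi, Fin.prod_univ_succ]
  simp only [u, Pi.neg_apply, Fin.cons_zero, Fin.cons_succ, Finset.prod_const, Finset.card_univ,
    Fintype.card_fin]
  rw [sub_neg_eq_add, ← ENNReal.ofReal_pow (by norm_num), ← ENNReal.ofReal_mul (by positivity),
    ← ENNReal.ofReal_mul (by positivity)]
  apply ENNReal.ofReal_le_ofReal
  apply le_of_eq
  field_simp
  ring

/-- Volume of a simplex. -/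
lemma simplex_ge {n : ℕ} (C : Set (Fin (n + 1) → ℝ)) (hC : Convex ℝ C)
    (x : Fin (n + 1) → ℝ) (a : Fin (n + 1) → (Fin (n + 1) → ℝ)) (hx : x ∈ C)
    (ha : ∀ i, a i ∈ C) :
    ENNReal.ofReal |(Q a).cramer (x - a 0) 0| ≤
      ENNReal.ofReal ((n + 1 : ℝ) ^ (n + 1)) * volume C := by
  let L := (Q a).updateCol 0 (x - a 0)
  let w : Fin (n + 1) → ℝ := fun _ => 1 / (n + 1 : ℝ)
  have hsub : (fun y => a 0 + y) '' (Matrix.toLin' L '' Set.Icc 0 w) ⊆ C := by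
    rintro _ ⟨_, ⟨c, ⟨hc0, hc1⟩, rfl⟩, rfl⟩
    let z : Fin (n + 2) → (Fin (n + 1) → ℝ) := Fin.cons (a 0) (Fin.cons x fun i => a i.succ)
    let wt : Fin (n + 2) → ℝ := Fin.cons (1 - ∑ i, c i) c
    have hsum : ∑ i, c i ≤ 1 := by
      calc ∑ i, c i ≤ ∑ i, w i := Finset.sum_le_sum fun i _ => hc1 i
        _ = 1 := by
          simp [w]
          field_simp
    have key : ∑ i, wt i • z i ∈ C := by
      refine hC.sum_mem (fun i _ => ?_) ?_ (fun i _ => ?_)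
      · refine Fin.cases ?_ (fun i => ?_) i
        · simpa [wt] using hsum
        · simpa [wt] using hc0 i
      · simp [wt, Fin.sum_univ_succ (n := n + 1)]
      · refine Fin.cases ?_ (fun i => Fin.cases ?_ (fun i => ?_) i) i
        · exact ha 0
        · exact hx
        · exact ha _
    convert key using 1
    ext r
    simp only [Pi.add_apply, Matrix.toLin'_apply, Matrix.mulVec, dotProduct, Finset.sum_apply,
      Pi.smul_apply, smul_eq_mul]
    rw [Fin.sum_univ_succ, Fin.sum_univ_succ (n := n + 1), Fin.sum_univ_succ (n := n)]
    simp only [L, wt, z, Q, Matrix.updateCol_self, Fin.cons_zero, Fin.cons_succ, Pi.sub_apply]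
    rw [Fin.sum_univ_succ (n := n)]
    have : ∀ i : Fin n, ((Matrix.of fun r => (Fin.cons (if r = 0 then 1 else 0)
        fun i : Fin n => a i.succ r - a 0 r : Fin (n + 1) → ℝ)).updateCol 0 (x - a 0)) r i.succ
        = a i.succ r - a 0 r := by
      intro i
      rw [Matrix.updateCol_ne (Fin.succ_ne_zero i)]
      simp
    simp only [this, sub_mul, Finset.sum_sub_distrib, ← Finset.mul_sum]
    simp only [mul_comm (c _)]
    ring
  have h := measure_mono (μ := volume) hsub
  rw [Set.image_add_left, measure_preimage_add, Measure.addHaar_image_linearMap, LinearMap.det_toLin',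
    Real.volume_Icc_pi] at h
  rw [Matrix.cramer_apply]
  calc ENNReal.ofReal |L.det| = ENNReal.ofReal ((n + 1 : ℝ) ^ (n + 1)) *
        (ENNReal.ofReal |L.det| * ∏ i, ENNReal.ofReal (w i - (0 : Fin (n + 1) → ℝ) i)) := by
        simp only [w, Pi.zero_apply, sub_zero, Finset.prod_const, Finset.card_univ,
          Fintype.card_fin]
        rw [← ENNReal.ofReal_pow (by positivity), ← ENNReal.ofReal_mul (by positivity),
          ← ENNReal.ofReal_mul (by positivity)]
        congr 1
        rw [mul_left_comm, ← mul_pow, mul_one_div_cancel (by positivity), one_pow, mul_one]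
    _ ≤ _ := by gcongr

/-- Combinatorial choice of the point to remove. -/
lemma exists_choice {n : ℕ} (A : Fin (n + 2) → (Fin (n + 1) → ℝ)) :
    ∃ j : Fin (n + 2), ∀ i : Fin n,
      |(Q (fun i => A (j.succAbove i))).cramer (A j - A (j.succAbove 0)) i.succ|
        ≤ |(Q (fun i => A (j.succAbove i))).det| := by
  let W : Matrix (Fin (n + 1)) (Fin (n + 2)) ℝ :=
    Matrix.of (Fin.cons (fun _ => 1) fun r i => A i r.succ)
  have hker : LinearMap.ker (Matrix.toLin' W) ≠ ⊥ :=
    LinearMap.ker_ne_bot_of_finrank_lt (by simp)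
  obtain ⟨l, hl, hl0⟩ := (Submodule.ne_bot_iff _).1 hker
  rw [LinearMap.mem_ker, Matrix.toLin'_apply] at hl
  obtain ⟨j, hj⟩ := Finite.exists_max fun i => |l i|
  have hlj : l j ≠ 0 := by
    intro h
    apply hl0
    ext i
    have := hj i
    rw [h, abs_zero] at this
    exact abs_nonpos_iff.1 this
  have e0 : ∑ i, l i = 0 := by
    have := congrFun hl 0
    simpa [W, Matrix.mulVec, dotProduct] using this
  have e1 : ∀ r : Fin n, ∑ i, A i r.succ * l i = 0 := by
    intro r
    have := congrFun hl r.succ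
    simpa [W, Matrix.mulVec, dotProduct] using this
  refine ⟨j, ?_⟩
  set a : Fin (n + 1) → (Fin (n + 1) → ℝ) := fun i => A (j.succAbove i) with ha
  let c' : Fin n → ℝ := fun i => - l (j.succAbove i.succ) / l j
  let c : Fin (n + 1) → ℝ :=
    Fin.cons (A j 0 - a 0 0 - ∑ i, (a i.succ 0 - a 0 0) * c' i) c'
  have hc : A j - a 0 = Matrix.mulVec (Q a) c := by
    ext r
    simp only [Matrix.mulVec, dotProduct, Pi.sub_apply]
    rw [Fin.sum_univ_succ]
    refine Fin.cases ?_ (fun r => ?_) r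
    · simp [Q, c]
    · have e0' := e0
      have e1' := e1 r
      rw [Fin.sum_univ_succAbove _ j, Fin.sum_univ_succ] at e0' e1'
      simp only [Q, c, c', Matrix.of_apply, Fin.cons_zero, Fin.cons_succ, Fin.succ_ne_zero,
        if_false, zero_mul, zero_add, mul_div_assoc', ← Finset.sum_div]
      rw [eq_div_iff hlj]
      simp only [mul_neg, sub_mul, Finset.sum_neg_distrib, Finset.sum_sub_distrib,
        ← Finset.mul_sum]
      simp only [ha]
      linear_combination e1' - A (j.succAbove 0) r.succ * e0'
  intro i
  change |(Q a).cramer (A j - a 0) i.succ| ≤ _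
  rw [hc, Matrix.cramer_eq_adjugate_mulVec, Matrix.mulVec_mulVec, Matrix.adjugate_mul,
    Matrix.smul_mulVec, Matrix.one_mulVec, Pi.smul_apply, smul_eq_mul, abs_mul]
  refine mul_le_of_le_one_right (abs_nonneg _) ?_
  simp only [c, c', Fin.cons_succ, abs_div, abs_neg]
  exact (div_le_one (abs_pos.2 hlj)).2 (hj _)

/-- The dominating set. -/
def H {n : ℕ} (T : Set (Fin (n + 1) → ℝ)) (K : ℝ) :
    Set ((Fin (n + 1) → ℝ) × (Fin (n + 1) → (Fin (n + 1) → ℝ))) :=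
  {p | (∀ i, p.2 i ∈ T) ∧ (∀ i : Fin n, |(Q p.2).cramer (p.1 - p.2 0) i.succ| ≤ |(Q p.2).det|) ∧
      |(Q p.2).cramer (p.1 - p.2 0) 0| ≤ K}

lemma measurable_H {n : ℕ} (T : Set (Fin (n + 1) → ℝ)) (hT : MeasurableSet T) (K : ℝ) :
    MeasurableSet (H T K) := by
  have hQ : Continuous fun p : (Fin (n + 1) → ℝ) × (Fin (n + 1) → (Fin (n + 1) → ℝ)) => Q p.2 :=
    continuous_Q.comp continuous_snd
  have hcr : ∀ i, Continuous fun p : (Fin (n + 1) → ℝ) × (Fin (n + 1) → (Fin (n + 1) → ℝ)) =>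
      |(Q p.2).cramer (p.1 - p.2 0) i| := by
    intro i
    simp only [Matrix.cramer_apply]
    refine (Continuous.matrix_det (hQ.matrix_updateCol i ?_)).abs
    fun_prop
  have h1 : MeasurableSet {p : (Fin (n + 1) → ℝ) × (Fin (n + 1) → (Fin (n + 1) → ℝ)) |
      ∀ i, p.2 i ∈ T} := by
    rw [Set.ofPred_forall]
    exact MeasurableSet.iInter fun i => ((measurable_pi_apply i).comp measurable_snd) hT
  have h2 : MeasurableSet {p : (Fin (n + 1) → ℝ) × (Fin (n + 1) → (Fin (n + 1) → ℝ)) |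
      ∀ i : Fin n, |(Q p.2).cramer (p.1 - p.2 0) i.succ| ≤ |(Q p.2).det|} := by
    rw [Set.ofPred_forall]
    exact MeasurableSet.iInter fun i =>
      (isClosed_le (hcr _) hQ.matrix_det.abs).measurableSet
  exact h1.inter (h2.inter (isClosed_le (hcr 0) continuous_const).measurableSet)

lemma volume_H_le {n : ℕ} (T : Set (Fin (n + 1) → ℝ)) (hT : MeasurableSet T) (K : ℝ)
    (hK : 0 ≤ K) :
    volume (H T K) ≤ ENNReal.ofReal (2 ^ (n + 1) * K) * volume T ^ (n + 1) := by
  rw [Measure.volume_eq_prod, Measure.prod_apply_symm (measurable_H T hT K)]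
  have hpi : MeasurableSet (Set.univ.pi fun _ : Fin (n + 1) => T) :=
    MeasurableSet.univ_pi fun _ => hT
  calc _ ≤ ∫⁻ a : Fin (n + 1) → (Fin (n + 1) → ℝ),
        (Set.univ.pi fun _ : Fin (n + 1) => T).indicator
          (fun _ => ENNReal.ofReal (2 ^ (n + 1) * K)) a := by
        apply lintegral_mono_ae
        filter_upwards [ae_det_Q] with a ha
        by_cases haT : a ∈ Set.univ.pi fun _ : Fin (n + 1) => T
        · rw [Set.indicator_of_mem haT]
          refine le_trans (measure_mono ?_) (slice_le a ha K hK)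
          intro x hx
          exact hx.2
        · rw [Set.indicator_of_notMem haT]
          have : ((fun x => (x, a)) ⁻¹' H T K) = ∅ := by
            ext x
            simp only [Set.mem_preimage, Set.mem_empty_iff_false, iff_false]
            intro hx
            exact haT fun i _ => hx.1 i
          rw [this, measure_empty]
    _ = _ := by
        rw [lintegral_indicator_const hpi, volume_pi_pi]
        simp

end BeerIndex

open BeerIndex

/-- For every `d ≥ 2` there is a constant `β > 0` such that every
`S ⊆ ℝᵈ` for which `b_d(S)` is defined satisfies `b_d(S) ≤ β · c(S)`. -/
theorem bd_le_beta_convexity_ratio (d : ℕ) (hd : 2 ≤ d) :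
    ∃ β : ℝ, 0 < β ∧ ∀ S : Set (Fin d → ℝ), volume S ≠ 0 → volume S ≠ ⊤ →
      MeasurableSet {A : Fin (d + 1) → (Fin d → ℝ) |
        (∀ i, A i ∈ S) ∧ convexHull ℝ (Set.range A) ⊆ S} →
      volume {A : Fin (d + 1) → (Fin d → ℝ) |
          (∀ i, A i ∈ S) ∧ convexHull ℝ (Set.range A) ⊆ S} / volume S ^ (d + 1) ≤
        ENNReal.ofReal β *
          ((⨆ (K : Set (Fin d → ℝ)) (_ : K ⊆ S ∧ Convex ℝ K), volume K) / volume S) := by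
  obtain ⟨n, rfl⟩ : ∃ n, d = n + 1 := ⟨d - 1, by omega⟩
  refine ⟨(n + 2) * (2 ^ (n + 1) * (n + 1 : ℝ) ^ (n + 1)), by positivity, ?_⟩
  intro S hS0 hST _
  set M := ⨆ (K : Set (Fin (n + 1) → ℝ)) (_ : K ⊆ S ∧ Convex ℝ K), volume K with hM
  have hMle : M ≤ volume S := iSup₂_le fun K hK => measure_mono hK.1
  have hMtop : M ≠ ⊤ := ne_top_of_le_ne_top hST hMle
  set K : ℝ := (n + 1 : ℝ) ^ (n + 1) * M.toReal with hK
  have hK0 : 0 ≤ K := by positivity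
  set T := toMeasurable volume S
  have hTm : MeasurableSet T := measurableSet_toMeasurable _ _
  have hTv : volume T = volume S := measure_toMeasurable _
  let e := fun j : Fin (n + 2) =>
    MeasurableEquiv.piFinSuccAbove (fun _ : Fin (n + 2) => (Fin (n + 1) → ℝ)) j
  have hcover : {A : Fin (n + 1 + 1) → (Fin (n + 1) → ℝ) |
      (∀ i, A i ∈ S) ∧ convexHull ℝ (Set.range A) ⊆ S} ⊆ ⋃ j, e j ⁻¹' H T K := by
    rintro A ⟨hA, hAS⟩
    obtain ⟨j, hj⟩ := exists_choice A
    refine Set.mem_iUnion.2 ⟨j, ?_⟩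
    change (A j, fun i => A (j.succAbove i)) ∈ H T K
    refine ⟨fun i => subset_toMeasurable _ _ (hA _), hj, ?_⟩
    have h1 := simplex_ge (convexHull ℝ (Set.range A)) (convex_convexHull ℝ _) (A j)
      (fun i => A (j.succAbove i)) (subset_convexHull ℝ _ ⟨j, rfl⟩)
      (fun i => subset_convexHull ℝ _ ⟨_, rfl⟩)
    have h2 : volume (convexHull ℝ (Set.range A)) ≤ M :=
      le_iSup₂_of_le (convexHull ℝ (Set.range A)) ⟨hAS, convex_convexHull ℝ _⟩ le_rfl
    have h3 := h1.trans (mul_le_mul_right h2 _)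
    rw [← ENNReal.ofReal_toReal hMtop, ← ENNReal.ofReal_mul (by positivity)] at h3
    exact (ENNReal.ofReal_le_ofReal_iff hK0).1 h3
  have hmain : volume {A : Fin (n + 1 + 1) → (Fin (n + 1) → ℝ) |
      (∀ i, A i ∈ S) ∧ convexHull ℝ (Set.range A) ⊆ S} ≤
      ENNReal.ofReal ((n + 2) * (2 ^ (n + 1) * (n + 1 : ℝ) ^ (n + 1))) * M *
        volume S ^ (n + 1) := by
    calc _ ≤ volume (⋃ j, e j ⁻¹' H T K) := measure_mono hcover
      _ ≤ ∑ j, volume (e j ⁻¹' H T K) := measure_iUnion_fintype_le _ _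
      _ = ∑ j : Fin (n + 2), volume (H T K) := by
          refine Finset.sum_congr rfl fun j _ => ?_
          exact (volume_preserving_piFinSuccAbove
            (fun _ : Fin (n + 2) => (Fin (n + 1) → ℝ)) j).measure_preimage
            (measurable_H T hTm K).nullMeasurableSet
      _ ≤ ∑ j : Fin (n + 2), ENNReal.ofReal (2 ^ (n + 1) * K) * volume T ^ (n + 1) :=
          Finset.sum_le_sum fun _ _ => volume_H_le T hTm K hK0
      _ = _ := by
          rw [Finset.sum_const, Finset.card_univ, Fintype.card_fin, nsmul_eq_mul, hTv,
            ← mul_assoc]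
          congr 1
          conv_rhs => rw [← ENNReal.ofReal_toReal hMtop]
          rw [← ENNReal.ofReal_mul (by positivity), ← ENNReal.ofReal_natCast,
            ← ENNReal.ofReal_mul (by positivity), hK]
          congr 1
          push_cast
          ring
  refine ENNReal.div_le_of_le_mul (hmain.trans (le_of_eq ?_))
  rw [pow_succ (volume S) (n + 1), ← mul_div_assoc, mul_comm (volume S ^ (n + 1)) (volume S),
    ← mul_assoc (_ / _), ENNReal.div_mul_cancel hS0 hST]
end
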